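/- Let G be a countable group acting by homeomorphisms on a compact Hausdorff space X, and fix g ∈ G. Then the set {x ∈ X : there exists an amenable subgroup N of G with N normal in the stabilizer G_x and g ∈ N} is a Borel subset of X (i.e., it is measurable with respect to the Borel σ-algebra of X). Equivalently, the set {x ∈ X : g ∈ R_a(G_x)} is Borel. -/

import Mathlib

/-- A group `N` is amenable if it admits a finitely additive, left-invariant
probability measure defined on all subsets of `N`. -/
def IsAmenable (N : Type*) [Group N] : Prop :=
  ∃ m : Set N → ℝ,
    m ∅ = 0 ∧
    m Set.univ = 1 ∧
    (∀ A B : Set N, Disjoint A B → m (A ∪ B) = m A + m B) ∧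
    (∀ (g : N) (A : Set N), m ((fun x => g * x) '' A) = m A)

open scoped Pointwise

/-- There is a normalized finitely additive real-valued function on the subsets of `G` that is
invariant under left translation by the elements of `S`. -/
def HasInvariantMean {G : Type*} [Group G] (S : Set G) : Prop :=
  ∃ m : Set G → ℝ, m Set.univ = 1 ∧
    (∀ A B : Set G, Disjoint A B → m (A ∪ B) = m A + m B) ∧
    ∀ s ∈ S, ∀ A : Set G, m (s • A) = m A

namespace HasInvariantMean

variable {G : Type*} [Group G]

theorem mono {S T : Set G} (h : S ⊆ T) (hT : HasInvariantMean T) : HasInvariantMean S := by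
  obtain ⟨m, h1, h2, h3⟩ := hT
  exact ⟨m, h1, h2, fun s hs => h3 s (h hs)⟩

theorem closure {S : Set G} (hS : HasInvariantMean S) :
    HasInvariantMean (Subgroup.closure S : Set G) := by
  obtain ⟨m, h1, h2, h3⟩ := hS
  refine ⟨m, h1, h2, fun s hs => ?_⟩
  induction hs using Subgroup.closure_induction with
  | mem x hx => exact h3 x hx
  | one => simp
  | mul x y _ _ hx hy => intro A; rw [mul_smul, hx, hy]
  | inv x _ hx => intro A; rw [← hx (x⁻¹ • A), smul_inv_smul]

/-- The linear relations that an `S`-invariant finitely additive function satisfies. -/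
noncomputable def relations (S : Set G) : Submodule ℝ (Set G →₀ ℝ) :=
  Submodule.span ℝ
    ({v | ∃ A B : Set G, Disjoint A B ∧
        v = Finsupp.single (A ∪ B) 1 - Finsupp.single A 1 - Finsupp.single B 1} ∪
      {v | ∃ s ∈ S, ∃ A : Set G, v = Finsupp.single (s • A) 1 - Finsupp.single A 1})

theorem iff_notMem_relations (S : Set G) :
    HasInvariantMean S ↔ Finsupp.single Set.univ 1 ∉ relations S := by
  constructor
  · rintro ⟨m, h1, h2, h3⟩ hmem
    have hle : relations S ≤ LinearMap.ker (Finsupp.linearCombination ℝ m) := by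
      refine Submodule.span_le.2 ?_
      rintro v (⟨A, B, hAB, rfl⟩ | ⟨s, hs, A, rfl⟩)
      · simp [h2 A B hAB]
      · simp [h3 s hs A]
    simpa [h1] using hle hmem
  · intro h
    obtain ⟨f, hf, hle⟩ := Submodule.exists_le_ker_of_notMem h
    have hadd : ∀ A B : Set G, Disjoint A B → f (Finsupp.single (A ∪ B) 1) =
        f (Finsupp.single A 1) + f (Finsupp.single B 1) := by
      intro A B hAB
      have := hle (Submodule.subset_span (Or.inl ⟨A, B, hAB, rfl⟩))
      simp only [LinearMap.mem_ker, map_sub] at this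
      linarith
    refine ⟨fun A => (f (Finsupp.single Set.univ 1))⁻¹ * f (Finsupp.single A 1),
      inv_mul_cancel₀ hf, ?_, ?_⟩
    · intro A B hAB
      simp only [hadd A B hAB, mul_add]
    · intro s hs A
      have := hle (Submodule.subset_span (Or.inr ⟨s, hs, A, rfl⟩))
      simp only [LinearMap.mem_ker, map_sub] at this
      simp only [sub_eq_zero.1 this]

theorem exists_finset_mem_relations {S : Set G} {v : Set G →₀ ℝ} (hv : v ∈ relations S) :
    ∃ T : Finset G, (T : Set G) ⊆ S ∧ v ∈ relations (T : Set G) := by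
  classical
  have relations_mono : ∀ {T U : Set G}, T ⊆ U → relations T ≤ relations U := fun h =>
    Submodule.span_mono (Set.union_subset_union_right _
      fun _ ⟨s, hs, A, hA⟩ => ⟨s, h hs, A, hA⟩)
  induction hv using Submodule.span_induction with
  | mem v hv =>
    rcases hv with hv | ⟨s, hs, hA⟩
    · exact ⟨∅, by simp, Submodule.subset_span (Or.inl hv)⟩
    · exact ⟨{s}, by simpa using hs, Submodule.subset_span (Or.inr ⟨s, by simp, hA⟩)⟩
  | zero => exact ⟨∅, by simp, zero_mem _⟩
  | add v w _ _ hv hw =>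
    obtain ⟨T, hT, hv⟩ := hv
    obtain ⟨U, hU, hw⟩ := hw
    exact ⟨T ∪ U, by simpa using ⟨hT, hU⟩,
      add_mem (relations_mono (by simp) hv) (relations_mono (by simp) hw)⟩
  | smul a v _ hv =>
    obtain ⟨T, hT, hv⟩ := hv
    exact ⟨T, hT, Submodule.smul_mem _ a hv⟩

theorem of_forall_finset {S : Set G}
    (h : ∀ T : Finset G, (T : Set G) ⊆ S → HasInvariantMean (T : Set G)) :
    HasInvariantMean S := by
  rw [iff_notMem_relations]
  intro hmem
  obtain ⟨T, hT, hmem⟩ := exists_finset_mem_relations hmem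
  exact (iff_notMem_relations _).1 (h T hT) hmem

end HasInvariantMean

theorem Subgroup.exists_equivariant_retraction {G : Type*} [Group G] (N : Subgroup G) :
    ∃ p : G → N, ∀ (n : N) (x : G), p (n * x) = n * p x := by
  let r : G → G := fun x => (Quotient.mk (QuotientGroup.rightRel N) x).out
  have hr : ∀ x, x * (r x)⁻¹ ∈ N := fun x =>
    QuotientGroup.rightRel_apply.1 (Quotient.mk_out (s := QuotientGroup.rightRel N) x)
  refine ⟨fun x => ⟨x * (r x)⁻¹, hr x⟩, fun n x => Subtype.ext ?_⟩
  have : r (n * x) = r x := by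
    refine congrArg Quotient.out (Quotient.sound ?_)
    refine QuotientGroup.rightRel_apply.2 ?_
    simp
  simp [this, mul_assoc]

theorem Subgroup.isAmenable_iff_hasInvariantMean {G : Type*} [Group G] (N : Subgroup G) :
    IsAmenable N ↔ HasInvariantMean (N : Set G) := by
  constructor
  · rintro ⟨m, -, h1, h2, h3⟩
    refine ⟨fun A => m (Subtype.val ⁻¹' A), by simpa using h1,
      fun A B hAB => h2 _ _ (hAB.preimage _), fun s hs A => ?_⟩
    refine Eq.trans (congrArg m ?_) (h3 ⟨s, hs⟩ _)
    ext x
    simp [Set.mem_smul_set_iff_inv_smul_mem]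
  · rintro ⟨m, h1, h2, h3⟩
    obtain ⟨p, hp⟩ := N.exists_equivariant_retraction
    refine ⟨fun A => m (p ⁻¹' A), ?_, by simpa using h1,
      fun A B hAB => h2 _ _ (hAB.preimage _), fun n A => ?_⟩
    · simpa using h2 ∅ ∅ disjoint_bot_left
    · refine Eq.trans (congrArg m ?_) (h3 n n.2 _)
      ext x
      have := hp n⁻¹ x
      simp only [InvMemClass.coe_inv] at this
      simp [Set.mem_smul_set_iff_inv_smul_mem, this]

/-- The amenable radical of `H` contains `g ∈ H` exactly when every finite set of `H`-conjugates of
`g` admits an invariant mean. -/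
theorem Subgroup.exists_amenable_normal_mem_iff {G : Type*} [Group G] (H : Subgroup G) (g : G) :
    (∃ N : Subgroup G, IsAmenable N ∧ N ≤ H ∧ (∀ h ∈ H, ∀ t ∈ N, h * t * h⁻¹ ∈ N) ∧ g ∈ N) ↔
      g ∈ H ∧ ∀ T : Finset G, (T : Set G) ⊆ H →
        HasInvariantMean ((fun t => t * g * t⁻¹) '' (T : Set G)) := by
  classical
  constructor
  · rintro ⟨N, hN, hNH, hconj, hg⟩
    refine ⟨hNH hg, fun T hT => ((isAmenable_iff_hasInvariantMean N).1 hN).mono ?_⟩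
    rintro _ ⟨t, ht, rfl⟩
    exact hconj t (hT ht) g hg
  · rintro ⟨hg, hT⟩
    refine ⟨closure ((fun t => t * g * t⁻¹) '' (H : Set G)), ?_, ?_, ?_, ?_⟩
    · rw [isAmenable_iff_hasInvariantMean]
      refine HasInvariantMean.closure (HasInvariantMean.of_forall_finset fun U hU => ?_)
      obtain ⟨T, hTH, rfl⟩ := Finset.subset_set_image_iff.1 hU
      simpa using hT T hTH
    · rw [closure_le]
      rintro _ ⟨t, ht, rfl⟩
      exact H.mul_mem (H.mul_mem ht hg) (H.inv_mem ht)
    · intro h hh t ht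
      induction ht using closure_induction with
      | mem x hx =>
        obtain ⟨t, ht, rfl⟩ := hx
        exact subset_closure ⟨h * t, H.mul_mem hh ht, by simp [mul_assoc]⟩
      | one => simp
      | mul x y _ _ hx hy => simpa [mul_assoc] using mul_mem hx hy
      | inv x _ hx => simpa [mul_assoc] using inv_mem hx
    · exact subset_closure ⟨1, H.one_mem, by simp⟩

/-- For a countable group acting by homeomorphisms on a compact Hausdorff space
and a fixed `g`, the set `{x : g ∈ R_a(G_x)}` is Borel. -/
theorem measurableSet_mem_amenable_radical_stabilizer
    (G : Type*) [Group G] [Countable G]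
    (X : Type*) [TopologicalSpace X] [CompactSpace X] [T2Space X]
    [MeasurableSpace X] [BorelSpace X]
    [MulAction G X] (hcont : ∀ g : G, Continuous fun x : X => g • x)
    (g : G) :
    MeasurableSet {x : X | ∃ N : Subgroup G, IsAmenable N ∧
      N ≤ MulAction.stabilizer G x ∧
      (∀ h ∈ MulAction.stabilizer G x, ∀ t ∈ N, h * t * h⁻¹ ∈ N) ∧ g ∈ N} := by
  have hfix : ∀ h : G, MeasurableSet {x : X | h ∈ MulAction.stabilizer G x} := fun h =>
    (isClosed_eq (hcont h) continuous_id).measurableSet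
  simp only [Subgroup.exists_amenable_normal_mem_iff]
  refine (hfix g).inter (measurableSet_setOfPred.2 (Measurable.forall fun T => ?_))
  refine Measurable.imp (measurableSet_setOfPred.1 ?_) measurable_const
  simp only [Set.subset_def, Set.ofPred_forall]
  exact MeasurableSet.iInter fun t => MeasurableSet.iInter fun _ => hfix t
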